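/- Let (E, g) be a polymatroid and let d ∈ ℝ^E with d_e > 0 for all e. For every strictly convex, continuously differentiable φ : ℝ_{≥0} → ℝ, the function x ↦ Σ_{e ∈ E} d_e · φ(x(e)/d_e) attains a unique minimizer over B(g); moreover, if φ₁ and φ₂ are both strictly convex and continuously differentiable, the unique minimizer of Σ_e d_e φ₁(x(e)/d_e) over B(g) coincides with the unique minimizer of Σ_e d_e φ₂(x(e)/d_e) over B(g). -/

import Mathlib

/-- A rank function on the finite ground set `Fin n`: nonnegative, zero on `∅`,
nondecreasing and submodular.  `(E, g)` is then a polymatroid. -/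
def IsRankFunction {n : ℕ} (g : Finset (Fin n) → ℝ) : Prop :=
  g ∅ = 0 ∧ (∀ A, 0 ≤ g A) ∧ (∀ A B : Finset (Fin n), A ⊆ B → g A ≤ g B) ∧
    ∀ A B : Finset (Fin n), g (A ∪ B) + g (A ∩ B) ≤ g A + g B

/-- The polymatroidal polyhedron `P(g)` of independent vectors. -/
def polyP {n : ℕ} (g : Finset (Fin n) → ℝ) : Set (Fin n → ℝ) :=
  {x | (∀ e, 0 ≤ x e) ∧ ∀ A : Finset (Fin n), ∑ e ∈ A, x e ≤ g A}

/-- The base `B(g)` of the polymatroid `(E, g)`. -/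
def polyBase {n : ℕ} (g : Finset (Fin n) → ℝ) : Set (Fin n → ℝ) :=
  {x ∈ polyP g | ∑ e, x e = g Finset.univ}

open Finset Filter Topology in
lemma polyBase_nonempty {n : ℕ} {g : Finset (Fin n) → ℝ} (hg : IsRankFunction g) :
    (polyBase g).Nonempty := by
  obtain ⟨h0, hnn, hmono, hsub⟩ := hg
  refine ⟨fun i => g (Finset.Iic i) - g (Finset.Iio i), ⟨⟨?_, ?_⟩, ?_⟩⟩
  · intro e
    have := hmono (Finset.Iio e) (Finset.Iic e) (fun a ha => by
      simp only [Finset.mem_Iio, Finset.mem_Iic] at *; exact ha.le)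
    simpa using this
  · intro A
    induction A using Finset.induction_on_max with
    | empty => simp [h0]
    | insert a s hs ih =>
      have ha : a ∉ s := fun h => lt_irrefl _ (hs a h)
      rw [Finset.sum_insert ha]
      have h1 : (insert a s) ∪ Finset.Iio a = Finset.Iic a := by
        ext b
        simp only [Finset.mem_union, Finset.mem_insert, Finset.mem_Iio, Finset.mem_Iic]
        constructor
        · rintro ((h | h) | h)
          · exact h.le
          · exact (hs b h).le
          · exact h.le
        · intro h
          rcases h.eq_or_lt with h | h
          · exact Or.inl (Or.inl h)
          · exact Or.inr h
      have h2 : (insert a s) ∩ Finset.Iio a = s := by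
        ext b
        simp only [Finset.mem_inter, Finset.mem_insert, Finset.mem_Iio]
        constructor
        · rintro ⟨h | h, h'⟩
          · exact absurd h' (by simp [h])
          · exact h
        · intro h
          exact ⟨Or.inr h, hs b h⟩
      have := hsub (insert a s) (Finset.Iio a)
      rw [h1, h2] at this
      linarith
  · have key : ∀ A : Finset (Fin n), (∀ a ∈ A, ∀ b < a, b ∈ A) →
        ∑ i ∈ A, (g (Finset.Iic i) - g (Finset.Iio i)) = g A := by
      intro A
      induction A using Finset.induction_on_max with
      | empty => simp [h0]
      | insert a s hs ih =>
        intro hl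
        have ha : a ∉ s := fun h => lt_irrefl _ (hs a h)
        have hsI : s = Finset.Iio a := by
          ext b
          simp only [Finset.mem_Iio]
          refine ⟨hs b, fun h => ?_⟩
          have := hl a (Finset.mem_insert_self _ _) b h
          rcases Finset.mem_insert.1 this with h' | h'
          · exact absurd h (by simp [h'])
          · exact h'
        rw [Finset.sum_insert ha, ih]
        · have : insert a s = Finset.Iic a := by
            rw [hsI]; exact Finset.Iio_insert a
          rw [this, ← hsI]; ring
        · intro c hc b hb
          rw [hsI] at hc ⊢
          simp only [Finset.mem_Iio] at *
          exact hb.trans hc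
    exact key Finset.univ (by simp)

lemma polyBase_compact {n : ℕ} (g : Finset (Fin n) → ℝ) : IsCompact (polyBase g) := by
  have hc : IsClosed (polyBase g) := by
    have : polyBase g = (⋂ e, {x : Fin n → ℝ | 0 ≤ x e}) ∩
        (⋂ A : Finset (Fin n), {x : Fin n → ℝ | ∑ e ∈ A, x e ≤ g A}) ∩
        {x : Fin n → ℝ | ∑ e, x e = g Finset.univ} := by
      ext x; simp [polyBase, polyP]
    rw [this]
    refine ((isClosed_iInter fun e => ?_).inter (isClosed_iInter fun A => ?_)).inter ?_
    · exact isClosed_le (by fun_prop) (by fun_prop)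
    · exact isClosed_le (by fun_prop) (by fun_prop)
    · exact isClosed_eq (by fun_prop) (by fun_prop)
  refine IsCompact.of_isClosed_subset (isCompact_Icc (a := (0 : Fin n → ℝ))
    (b := fun e => g {e})) hc ?_
  intro x hx
  refine ⟨fun e => hx.1.1 e, fun e => ?_⟩
  have := hx.1.2 {e}
  simpa using this

lemma exchange_decrease {φ : ℝ → ℝ} (hφ : StrictConvexOn ℝ (Set.Ici 0) φ)
    {a b p q ε : ℝ} (ha : 0 ≤ a) (hp : 0 < p) (hq : 0 < q) (hε : 0 < ε)
    (h : a + ε / p < b - ε / q) :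
    p * φ (a + ε / p) + q * φ (b - ε / q) < p * φ a + q * φ b := by
  have h1 : 0 < ε / p := div_pos hε hp
  have h2 : 0 < ε / q := div_pos hε hq
  have s1 := hφ.slope_strict_mono_adjacent (x := a) (y := a + ε / p) (z := b - ε / q)
    ha (by simp only [Set.mem_Ici]; linarith) (by linarith) h
  have s2 := hφ.slope_strict_mono_adjacent (x := a + ε / p) (y := b - ε / q) (z := b)
    (by simp only [Set.mem_Ici]; linarith) (by simp only [Set.mem_Ici]; linarith) h (by linarith)
  have s := s1.trans s2
  have e1 : a + ε / p - a = ε / p := by ring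
  have e2 : b - (b - ε / q) = ε / q := by ring
  rw [e1, e2] at s
  have := mul_lt_mul_of_pos_right s hε
  have t1 : (φ (a + ε / p) - φ a) / (ε / p) * ε = p * (φ (a + ε / p) - φ a) := by
    field_simp
  have t2 : (φ b - φ (b - ε / q)) / (ε / q) * ε = q * (φ b - φ (b - ε / q)) := by
    field_simp
  rw [t1, t2] at this
  linarith

open Filter Topology in
lemma exists_tight {n : ℕ} {g : Finset (Fin n) → ℝ} {d : Fin n → ℝ} (hd : ∀ e, 0 < d e)
    {φ : ℝ → ℝ} (hφ : StrictConvexOn ℝ (Set.Ici 0) φ) {x : Fin n → ℝ} (hx : x ∈ polyBase g)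
    (hmin : ∀ y ∈ polyBase g, ∑ e, d e * φ (x e / d e) ≤ ∑ e, d e * φ (y e / d e))
    {e f : Fin n} (hef : x e / d e < x f / d f) :
    ∃ A : Finset (Fin n), e ∈ A ∧ f ∉ A ∧ ∑ i ∈ A, x i = g A := by
  by_contra hcon
  push Not at hcon
  have hne : e ≠ f := by rintro rfl; exact lt_irrefl _ hef
  have hev1 : ∀ᶠ ε in 𝓝[>] (0 : ℝ), ∀ A : Finset (Fin n), e ∈ A → f ∉ A →
      ∑ i ∈ A, x i + ε < g A := by
    rw [eventually_all]
    intro A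
    by_cases hA : e ∈ A ∧ f ∉ A
    · have hlt : ∑ i ∈ A, x i + 0 < g A := by
        rw [add_zero]; exact lt_of_le_of_ne (hx.1.2 A) (hcon A hA.1 hA.2)
      have : ContinuousAt (fun ε : ℝ => ∑ i ∈ A, x i + ε) 0 := by fun_prop
      filter_upwards [nhdsWithin_le_nhds (this.eventually_lt_const hlt)] with ε h _ _ using h
    · filter_upwards with ε h1 h2 using absurd ⟨h1, h2⟩ hA
  have hev2 : ∀ᶠ ε in 𝓝[>] (0 : ℝ), x e / d e + ε / d e < x f / d f - ε / d f := by
    have c1 : ContinuousAt (fun ε : ℝ => x e / d e + ε / d e) 0 := by fun_prop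
    have c2 : ContinuousAt (fun ε : ℝ => x f / d f - ε / d f) 0 := by fun_prop
    exact nhdsWithin_le_nhds (c1.eventually_lt c2 (by simpa using hef))
  obtain ⟨ε, ⟨h1, h2⟩, hε⟩ := ((hev1.and hev2).and self_mem_nhdsWithin).exists
  replace hε : 0 < ε := hε
  let y : Fin n → ℝ := fun i => x i + ((if i = e then ε else 0) - (if i = f then ε else 0))
  have hye : y e = x e + ε := by simp [y, hne]
  have hyf : y f = x f - ε := by simp [y, hne.symm]; ring
  have hyo : ∀ i, i ≠ e → i ≠ f → y i = x i := by intro i hi hj; simp [y, hi, hj]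
  have hsum : ∀ A : Finset (Fin n), ∑ i ∈ A, y i =
      ∑ i ∈ A, x i + ((if e ∈ A then ε else 0) - (if f ∈ A then ε else 0)) := by
    intro A
    simp only [y, Finset.sum_add_distrib, Finset.sum_sub_distrib, Finset.sum_ite_eq']
  have hyB : y ∈ polyBase g := by
    refine ⟨⟨?_, ?_⟩, ?_⟩
    · intro i
      by_cases hi : i = e
      · rw [hi, hye]; have := hx.1.1 e; linarith
      by_cases hj : i = f
      · rw [hj, hyf]
        have h3 : 0 ≤ x e / d e := div_nonneg (hx.1.1 e) (hd e).le
        have h4 : 0 < ε / d e := div_pos hε (hd e)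
        have h5 : 0 < (x f - ε) / d f := by rw [sub_div]; linarith
        exact ((div_pos_iff_of_pos_right (hd f)).1 h5).le
      · rw [hyo i hi hj]; exact hx.1.1 i
    · intro A
      rw [hsum]
      have hA := hx.1.2 A
      by_cases hi : e ∈ A <;> by_cases hj : f ∈ A
      · simp [hi, hj]; linarith
      · have := h1 A hi hj
        simp [hi, hj]; linarith
      · simp [hi, hj]; linarith
      · simp [hi, hj]; linarith
    · rw [hsum]; simp; exact hx.2
  have hm := hmin y hyB
  have hdec := exchange_decrease hφ (div_nonneg (hx.1.1 e) (hd e).le) (hd e) (hd f) hε h2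
  have hsplit : ∀ F : Fin n → ℝ, ∑ i, F i = F e + F f + ∑ i ∈ (Finset.univ.erase e).erase f, F i := by
    intro F
    rw [← Finset.add_sum_erase _ _ (Finset.mem_univ e),
      ← Finset.add_sum_erase (Finset.univ.erase e) _ (by simp [hne.symm] : f ∈ Finset.univ.erase e)]
    ring
  rw [hsplit, hsplit (fun i => d i * φ (y i / d i))] at hm
  have hrest : ∑ i ∈ (Finset.univ.erase e).erase f, d i * φ (y i / d i) =
      ∑ i ∈ (Finset.univ.erase e).erase f, d i * φ (x i / d i) := by
    refine Finset.sum_congr rfl fun i hi => ?_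
    simp only [Finset.mem_erase] at hi
    rw [hyo i hi.2.1 hi.1]
  rw [hrest] at hm
  simp only [hye, hyf, add_div, sub_div] at hm
  linarith

lemma level_tight {n : ℕ} {g : Finset (Fin n) → ℝ} (hg : IsRankFunction g)
    {d : Fin n → ℝ} {x : Fin n → ℝ} (hx : x ∈ polyBase g)
    (h : ∀ e f, x e / d e < x f / d f →
      ∃ A : Finset (Fin n), e ∈ A ∧ f ∉ A ∧ ∑ i ∈ A, x i = g A) (t : ℝ) :
    ∑ i ∈ Finset.univ.filter (fun i => x i / d i ≤ t), x i =
      g (Finset.univ.filter (fun i => x i / d i ≤ t)) := by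
  obtain ⟨h0, hnn, hmono, hsub⟩ := hg
  have hui : ∀ A B : Finset (Fin n), ∑ i ∈ A, x i = g A → ∑ i ∈ B, x i = g B →
      ∑ i ∈ A ∪ B, x i = g (A ∪ B) ∧ ∑ i ∈ A ∩ B, x i = g (A ∩ B) := by
    intro A B hA hB
    have h1 := Finset.sum_union_inter (s₁ := A) (s₂ := B) (f := x)
    have h2 := hx.1.2 (A ∪ B)
    have h3 := hx.1.2 (A ∩ B)
    have h4 := hsub A B
    constructor <;> linarith
  have h' : ∀ e f, ∃ A : Finset (Fin n), x e / d e < x f / d f →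
      (e ∈ A ∧ f ∉ A) ∧ ∑ i ∈ A, x i = g A := by
    intro e f
    by_cases hlt : x e / d e < x f / d f
    · obtain ⟨A, h1, h2, h3⟩ := h e f hlt
      exact ⟨A, fun _ => ⟨⟨h1, h2⟩, h3⟩⟩
    · exact ⟨∅, fun h => absurd h hlt⟩
  choose T hT using h'
  set L := Finset.univ.filter (fun i => x i / d i ≤ t) with hL
  have hlt : ∀ e ∈ L, ∀ f ∈ Lᶜ, x e / d e < x f / d f := by
    intro e he f hf
    simp only [hL, Finset.mem_compl, Finset.mem_filter, Finset.mem_univ, true_and, not_le] at he hf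
    exact he.trans_lt hf
  have hLe : L = L.sup (fun e => Lᶜ.inf (T e)) := by
    ext i
    rw [Finset.mem_sup]
    constructor
    · intro hi
      exact ⟨i, hi, Finset.mem_inf.2 fun f hf => (hT i f (hlt i hi f hf)).1.1⟩
    · rintro ⟨e, he, hi⟩
      by_contra hn
      have hn' : i ∈ Lᶜ := Finset.mem_compl.2 hn
      exact (hT e i (hlt e he i hn')).1.2 (Finset.mem_inf.1 hi i hn')
  rw [hLe]
  refine Finset.sup_induction (p := fun A : Finset (Fin n) => ∑ i ∈ A, x i = g A) ?_ ?_ ?_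
  · simp [h0]
  · intro A hA B hB; exact (hui A B hA hB).1
  · intro e he
    refine Finset.inf_induction (p := fun A : Finset (Fin n) => ∑ i ∈ A, x i = g A) ?_ ?_ ?_
    · exact hx.2
    · intro A hA B hB; exact (hui A B hA hB).2
    · intro f hf
      exact (hT e f (hlt e he f hf)).2

/-- If the lower level sets of `x / d` are tight then no base `y` can, at an index of minimal
`min (x / d) (y / d)` among those where `x` and `y` differ, exceed `x`. -/
lemma no_first_diff {n : ℕ} {g : Finset (Fin n) → ℝ}
    {d : Fin n → ℝ} (hd : ∀ e, 0 < d e) {x y : Fin n → ℝ} (hy : y ∈ polyBase g)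
    (hlev : ∀ t, ∑ i ∈ Finset.univ.filter (fun i => x i / d i ≤ t), x i =
      g (Finset.univ.filter (fun i => x i / d i ≤ t)))
    (e : Fin n) (he : x e < y e)
    (hfirst : ∀ i, x i ≠ y i → x e / d e ≤ min (x i / d i) (y i / d i)) : False := by
  have h1 := hy.1.2 (Finset.univ.filter (fun i => x i / d i ≤ x e / d e))
  rw [← hlev] at h1
  refine absurd h1 (not_le.2 ?_)
  refine Finset.sum_lt_sum ?_ ⟨e, by simp, he⟩
  intro i hi
  simp only [Finset.mem_filter, Finset.mem_univ, true_and] at hi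
  by_cases hxy : x i = y i
  · exact hxy.le
  · have h2 := hi.trans ((hfirst i hxy).trans (min_le_right _ _))
    exact (div_le_div_iff_of_pos_right (hd i)).1 h2

lemma minimizers_eq {n : ℕ} {g : Finset (Fin n) → ℝ} {d : Fin n → ℝ} (hd : ∀ e, 0 < d e)
    {x y : Fin n → ℝ} (hx : x ∈ polyBase g) (hy : y ∈ polyBase g)
    (hlx : ∀ t, ∑ i ∈ Finset.univ.filter (fun i => x i / d i ≤ t), x i =
      g (Finset.univ.filter (fun i => x i / d i ≤ t)))
    (hly : ∀ t, ∑ i ∈ Finset.univ.filter (fun i => y i / d i ≤ t), y i =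
      g (Finset.univ.filter (fun i => y i / d i ≤ t))) : x = y := by
  by_contra hne
  obtain ⟨i, hi⟩ := Function.ne_iff.1 hne
  obtain ⟨e, he, hmin⟩ := Finset.exists_min_image
    (Finset.univ.filter (fun i => x i ≠ y i)) (fun i => min (x i / d i) (y i / d i))
    ⟨i, by simpa using hi⟩
  simp only [Finset.mem_filter, Finset.mem_univ, true_and] at he hmin
  rcases lt_or_gt_of_ne he with h | h
  · refine no_first_diff hd hy hlx e h fun i hi => ?_
    have := hmin i hi
    rwa [min_eq_left ((div_le_div_iff_of_pos_right (hd e)).2 h.le)] at this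
  · refine no_first_diff hd hx hly e h fun i hi => ?_
    have := hmin i (Ne.symm hi)
    rw [min_comm (y i / d i)]
    rwa [min_eq_right ((div_le_div_iff_of_pos_right (hd e)).2 h.le)] at this

/-- For every strictly convex, continuously differentiable `φ`, the `d`-separable
objective `∑_e d_e · φ(x(e)/d_e)` has a unique minimizer over `B(g)`; moreover the
unique minimizers for two such functions `φ₁, φ₂` coincide. -/
theorem dSeparable_unique_minimizer (n : ℕ) (g : Finset (Fin n) → ℝ)
    (hg : IsRankFunction g) (d : Fin n → ℝ) (hd : ∀ e, 0 < d e) :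
    (∀ φ : ℝ → ℝ, StrictConvexOn ℝ (Set.Ici 0) φ → ContDiffOn ℝ 1 φ (Set.Ici 0) →
      ∃! x : Fin n → ℝ, x ∈ polyBase g ∧
        ∀ y ∈ polyBase g,
          ∑ e, d e * φ (x e / d e) ≤ ∑ e, d e * φ (y e / d e)) ∧
    (∀ φ₁ φ₂ : ℝ → ℝ,
      StrictConvexOn ℝ (Set.Ici 0) φ₁ → ContDiffOn ℝ 1 φ₁ (Set.Ici 0) →
      StrictConvexOn ℝ (Set.Ici 0) φ₂ → ContDiffOn ℝ 1 φ₂ (Set.Ici 0) →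
      ∀ x₁ x₂ : Fin n → ℝ,
        (x₁ ∈ polyBase g ∧ ∀ y ∈ polyBase g,
          ∑ e, d e * φ₁ (x₁ e / d e) ≤ ∑ e, d e * φ₁ (y e / d e)) →
        (x₂ ∈ polyBase g ∧ ∀ y ∈ polyBase g,
          ∑ e, d e * φ₂ (x₂ e / d e) ≤ ∑ e, d e * φ₂ (y e / d e)) →
        x₁ = x₂) := by
  have hco : ∀ φ₁ φ₂ : ℝ → ℝ,
      StrictConvexOn ℝ (Set.Ici 0) φ₁ → StrictConvexOn ℝ (Set.Ici 0) φ₂ →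
      ∀ x₁ x₂ : Fin n → ℝ,
        (x₁ ∈ polyBase g ∧ ∀ y ∈ polyBase g,
          ∑ e, d e * φ₁ (x₁ e / d e) ≤ ∑ e, d e * φ₁ (y e / d e)) →
        (x₂ ∈ polyBase g ∧ ∀ y ∈ polyBase g,
          ∑ e, d e * φ₂ (x₂ e / d e) ≤ ∑ e, d e * φ₂ (y e / d e)) →
        x₁ = x₂ := by
    intro φ₁ φ₂ h1 h2 x₁ x₂ m1 m2
    exact minimizers_eq hd m1.1 m2.1
      (level_tight hg m1.1 fun e f h => exists_tight hd h1 m1.1 m1.2 h)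
      (level_tight hg m2.1 fun e f h => exists_tight hd h2 m2.1 m2.2 h)
  refine ⟨?_, fun φ₁ φ₂ h1 _ h2 _ => hco φ₁ φ₂ h1 h2⟩
  intro φ hφ hC
  have hcont : ContinuousOn (fun x : Fin n → ℝ => ∑ e, d e * φ (x e / d e)) (polyBase g) := by
    refine continuousOn_finsetSum _ fun e _ => continuousOn_const.mul ?_
    refine hC.continuousOn.comp (by fun_prop) ?_
    intro x hx
    exact div_nonneg (hx.1.1 e) (hd e).le
  obtain ⟨x, hx, hmin⟩ := (polyBase_compact g).exists_isMinOn (polyBase_nonempty hg) hcont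
  have hm : x ∈ polyBase g ∧ ∀ y ∈ polyBase g,
      ∑ e, d e * φ (x e / d e) ≤ ∑ e, d e * φ (y e / d e) := ⟨hx, fun y hy => hmin hy⟩
  exact ⟨x, hm, fun z hz => hco φ φ hφ hφ z x hz hm⟩
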